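/- Let L ≥ 2 be an integer, J ∈ ℝ, h : Fin L → ℝ, B = (Fin L → Bool), and let H and U be the random-field Heisenberg Hamiltonian and twist matrix. Let ψ ∈ B → ℂ be any vector all of whose entries are real. Then ψ† (∑_{j=1}^{L} (S⁺_j S⁻_{j+1} − S⁻_j S⁺_{j+1})) ψ = 0, and consequently ψ† (U⁻¹ H U − H) ψ = (J/2)(cos(2π/L) − 1) · ∑_{j=1}^{L} ψ† (S⁺_j S⁻_{j+1} + S⁻_j S⁺_{j+1}) ψ. -/

import Mathlib

open Complex Matrix

noncomputable section

/-- Spin value of a boolean: `1/2` for up (`true`), `-1/2` for down (`false`). -/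
def sval (b : Bool) : ℝ := if b then 1/2 else -1/2

/-- Diagonal entry of the twist operator for a spin configuration `s`:
`exp((2πi/L) ∑_{j=1}^L j · val(s_j))`, where site `j ∈ {1,…,L}` is coordinate
`j - 1` of `Fin L`. -/
def twistEntry (L : ℕ) (s : Fin L → Bool) : ℂ :=
  Complex.exp ((2 * Real.pi * Complex.I / L) *
    ∑ j : Fin L, ((j.val : ℂ) + 1) * ((sval (s j) : ℝ) : ℂ))

/-- The twist operator as a diagonal matrix on the configuration space. -/
def twistMat (L : ℕ) : Matrix (Fin L → Bool) (Fin L → Bool) ℂ :=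
  Matrix.diagonal (fun s => twistEntry L s)

/-- The spin operator `S^z_j`, diagonal with entry `val(s_j)`. -/
def Sz (L : ℕ) (j : Fin L) : Matrix (Fin L → Bool) (Fin L → Bool) ℂ :=
  Matrix.diagonal (fun s => ((sval (s j) : ℝ) : ℂ))

/-- The raising operator `S⁺_j`: entry `(s, t)` is `1` iff `s` is obtained from
`t` by flipping the spin at site `j` from down to up. -/
def Sp (L : ℕ) (j : Fin L) : Matrix (Fin L → Bool) (Fin L → Bool) ℂ :=
  fun s t =>
    if s j = true ∧ t j = false ∧ ∀ k : Fin L, k ≠ j → s k = t k then 1 else 0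

/-- The lowering operator `S⁻_j = (S⁺_j)ᵀ`. -/
def Sm (L : ℕ) (j : Fin L) : Matrix (Fin L → Bool) (Fin L → Bool) ℂ := (Sp L j)ᵀ

/-- `S^x_j = (S⁺_j + S⁻_j)/2`. -/
def Sx (L : ℕ) (j : Fin L) : Matrix (Fin L → Bool) (Fin L → Bool) ℂ :=
  ((1 : ℂ)/2) • (Sp L j + Sm L j)

/-- `S^y_j = (S⁺_j − S⁻_j)/(2i)`. -/
def Sy (L : ℕ) (j : Fin L) : Matrix (Fin L → Bool) (Fin L → Bool) ℂ :=
  ((1 : ℂ)/(2 * Complex.I)) • (Sp L j - Sm L j)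

/-- The random-field Heisenberg Hamiltonian
`H = ∑_j (J (S^x_j S^x_{j+1} + S^y_j S^y_{j+1} + S^z_j S^z_{j+1}) − h_j S^z_j)`,
with periodic boundary conditions (`j + 1` taken cyclically in `Fin L`). -/
def Ham (L : ℕ) [NeZero L] (J : ℝ) (h : Fin L → ℝ) :
    Matrix (Fin L → Bool) (Fin L → Bool) ℂ :=
  ∑ j : Fin L,
    ((J : ℂ) • (Sx L j * Sx L (j + 1) + Sy L j * Sy L (j + 1)
        + Sz L j * Sz L (j + 1))
      - ((h j : ℝ) : ℂ) • Sz L j)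

end


/-- Raising site `k` commutes with lowering a different site `j`. -/
theorem Sp_mul_Sm_comm (L : ℕ) {j k : Fin L} (hjk : j ≠ k) :
    Sp L k * Sm L j = Sm L j * Sp L k := by
  ext s t
  simp only [Matrix.mul_apply, Sm, Matrix.transpose_apply]
  rw [Finset.sum_eq_single (Function.update s k false),
    Finset.sum_eq_single (Function.update s j true)]
  · simp only [Sp, ← ite_and, mul_ite, mul_one, mul_zero]
    congr 1
    apply propext
    constructor
    · rintro ⟨⟨ht, hs, h1⟩, hs', -, h2⟩
      refine ⟨⟨?_, ?_, ?_⟩, ?_, ?_, ?_⟩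
      · simpa [hjk.symm] using hs'
      · simpa using h1 k hjk.symm
      · intro l hl
        by_cases hlj : l = j
        · subst hlj; simpa using ht.symm
        · simpa [hlj, hl] using (h1 l hlj).symm
      · simp
      · simpa [hjk] using hs
      · intro l hl; simp [hl]
    · rintro ⟨⟨hs, ht, h1⟩, -, hs', h2⟩
      refine ⟨⟨?_, ?_, ?_⟩, ?_, ?_, ?_⟩
      · simpa using (h1 j hjk).symm
      · simpa [hjk] using hs'
      · intro l hl
        by_cases hlk : l = k
        · subst hlk; simpa using ht
        · simpa [hlk, hl] using (h1 l hlk).symm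
      · simpa [hjk.symm] using hs
      · simp
      · intro l hl; simp [hl]
  · intro u _ hu
    have : Sp L j u s = 0 := by
      rw [Sp, if_neg]
      rintro ⟨h1, -, h3⟩
      exact hu (Function.eq_update_iff.2 ⟨h1, h3⟩)
    rw [this, zero_mul]
  · simp
  · intro u _ hu
    have : Sp L k s u = 0 := by
      rw [Sp, if_neg]
      rintro ⟨-, h1, h3⟩
      exact hu (Function.eq_update_iff.2 ⟨h1, fun l hl => (h3 l hl).symm⟩)
    rw [this, zero_mul]
  · simp

/-- The phase `exp(2πi (j + 1) / L)` that the twist operator attaches to site `j` of `Fin L`. -/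
noncomputable def twistPhase (L : ℕ) (j : Fin L) : ℂ :=
  Complex.exp ((2 * Real.pi * Complex.I / L) * ((j.val : ℂ) + 1))

theorem twistPhase_ne_zero (L : ℕ) (j : Fin L) : twistPhase L j ≠ 0 :=
  Complex.exp_ne_zero _

theorem twistPhase_add_one (L : ℕ) [NeZero L] (hL : 2 ≤ L) (j : Fin L) :
    twistPhase L (j + 1) = Complex.exp (2 * Real.pi * Complex.I / L) * twistPhase L j := by
  have hL0 : (L : ℂ) ≠ 0 := Nat.cast_ne_zero.2 (NeZero.ne L)
  have h1 : ((1 : Fin L) : ℕ) = 1 := by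
    rw [Fin.val_one', Nat.mod_eq_of_lt (by omega)]
  rw [twistPhase, twistPhase, ← Complex.exp_add]
  by_cases hj : j.val + 1 < L
  · have hv : (j + 1).val = j.val + 1 := by
      rw [Fin.val_add, h1, Nat.mod_eq_of_lt hj]
    rw [hv]
    push_cast
    ring_nf
  · have hjL : j.val + 1 = L := by have := j.isLt; omega
    have hv : (j + 1).val = 0 := by
      rw [Fin.val_add, h1, hjL, Nat.mod_self]
    have hc : (j.val : ℂ) + 1 = L := by exact_mod_cast hjL
    rw [hv, hc, div_mul_cancel₀ _ hL0, Complex.exp_add, Complex.exp_two_pi_mul_I]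
    simp

/-- Raising the spin at site `j` multiplies the twist factor by the phase of site `j`. -/
theorem twistEntry_of_raise (L : ℕ) {j : Fin L} {s t : Fin L → Bool} (hs : s j = true)
    (ht : t j = false) (hst : ∀ k : Fin L, k ≠ j → s k = t k) :
    twistEntry L s = twistPhase L j * twistEntry L t := by
  have hsum : ∑ k : Fin L, ((k.val : ℂ) + 1) * ((sval (s k) : ℝ) : ℂ)
      = ((j.val : ℂ) + 1) + ∑ k : Fin L, ((k.val : ℂ) + 1) * ((sval (t k) : ℝ) : ℂ) := by
    rw [← sub_eq_iff_eq_add, ← Finset.sum_sub_distrib, Finset.sum_eq_single j]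
    · rw [hs, ht]
      norm_num [sval]
      ring
    · intro k _ hk
      rw [hst k hk, sub_self]
    · simp
  rw [twistEntry, twistEntry, twistPhase, hsum, mul_add, Complex.exp_add]

theorem twistMat_mul_Sp (L : ℕ) (j : Fin L) :
    twistMat L * Sp L j = twistPhase L j • (Sp L j * twistMat L) := by
  ext s t
  rw [twistMat, Matrix.diagonal_mul, Matrix.smul_apply, Matrix.mul_diagonal, smul_eq_mul, Sp]
  split_ifs with h
  · rw [twistEntry_of_raise L h.1 h.2.1 h.2.2]
    ring
  · simp

theorem Sm_mul_twistMat (L : ℕ) (j : Fin L) :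
    Sm L j * twistMat L = twistPhase L j • (twistMat L * Sm L j) := by
  have h := congrArg Matrix.transpose (twistMat_mul_Sp L j)
  simpa [Matrix.transpose_mul, twistMat, Sm] using h

theorem Sp_mul_twistMat (L : ℕ) (j : Fin L) :
    Sp L j * twistMat L = (twistPhase L j)⁻¹ • (twistMat L * Sp L j) := by
  rw [twistMat_mul_Sp, inv_smul_smul₀ (twistPhase_ne_zero L j)]

theorem Sp_mul_Sm_mul_twistMat (L : ℕ) (j k : Fin L) :
    Sp L j * Sm L k * twistMat L
      = (twistPhase L k / twistPhase L j) • (twistMat L * (Sp L j * Sm L k)) := by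
  rw [Matrix.mul_assoc, Sm_mul_twistMat, Matrix.mul_smul, ← Matrix.mul_assoc, Sp_mul_twistMat,
    Matrix.smul_mul, smul_smul, Matrix.mul_assoc, div_eq_mul_inv]

theorem Sm_mul_Sp_mul_twistMat (L : ℕ) (j k : Fin L) :
    Sm L j * Sp L k * twistMat L
      = (twistPhase L j / twistPhase L k) • (twistMat L * (Sm L j * Sp L k)) := by
  rw [Matrix.mul_assoc, Sp_mul_twistMat, Matrix.mul_smul, ← Matrix.mul_assoc, Sm_mul_twistMat,
    Matrix.smul_mul, smul_smul, Matrix.mul_assoc, div_eq_inv_mul]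

theorem twistMat_inv_mul (L : ℕ) : (twistMat L)⁻¹ * twistMat L = 1 := by
  apply Matrix.nonsing_inv_mul
  rw [twistMat, Matrix.det_diagonal, isUnit_iff_ne_zero]
  exact Finset.prod_ne_zero_iff.2 fun s _ => Complex.exp_ne_zero _

theorem twistMat_conj_of_mul_eq_smul (L : ℕ) {c : ℂ}
    {A : Matrix (Fin L → Bool) (Fin L → Bool) ℂ}
    (hA : A * twistMat L = c • (twistMat L * A)) :
    (twistMat L)⁻¹ * A * twistMat L = c • A := by
  rw [Matrix.mul_assoc, hA, Matrix.mul_smul, ← Matrix.mul_assoc, twistMat_inv_mul,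
    Matrix.one_mul]

theorem twistMat_conj_Sz (L : ℕ) (j : Fin L) :
    (twistMat L)⁻¹ * Sz L j * twistMat L = Sz L j := by
  rw [twistMat_conj_of_mul_eq_smul L (c := 1), one_smul]
  rw [one_smul, Sz, twistMat, Matrix.diagonal_mul_diagonal, Matrix.diagonal_mul_diagonal]
  simp only [mul_comm]

theorem twistMat_conj_Sz_mul_Sz (L : ℕ) (j k : Fin L) :
    (twistMat L)⁻¹ * (Sz L j * Sz L k) * twistMat L = Sz L j * Sz L k := by
  rw [twistMat_conj_of_mul_eq_smul L (c := 1), one_smul]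
  simp only [one_smul, Sz, twistMat, Matrix.diagonal_mul_diagonal]
  simp only [mul_comm]

/-- The transverse exchange term in terms of raising and lowering operators. -/
theorem Sx_mul_Sx_add_Sy_mul_Sy (L : ℕ) (j k : Fin L) :
    Sx L j * Sx L k + Sy L j * Sy L k
      = ((1 : ℂ) / 2) • (Sp L j * Sm L k + Sm L j * Sp L k) := by
  have hI : (1 : ℂ) / (2 * Complex.I) * (1 / (2 * Complex.I)) = -(1 / 4) := by
    field_simp
    rw [Complex.I_sq]
    norm_num
  simp only [Sx, Sy, Matrix.smul_mul, Matrix.mul_smul, smul_smul, hI]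
  simp only [Matrix.add_mul, Matrix.mul_add, Matrix.sub_mul, Matrix.mul_sub]
  module

/-- Conjugating the Hamiltonian by the twist only changes the hopping terms. -/
theorem twistMat_conj_Ham_sub_Ham (L : ℕ) [NeZero L] (hL : 2 ≤ L) (J : ℝ) (h : Fin L → ℝ) :
    (twistMat L)⁻¹ * Ham L J h * twistMat L - Ham L J h
      = ∑ j : Fin L, ((J : ℂ) / 2) •
          ((Complex.exp (2 * Real.pi * Complex.I / L) - 1) • (Sp L j * Sm L (j + 1))
            + ((Complex.exp (2 * Real.pi * Complex.I / L))⁻¹ - 1) •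
              (Sm L j * Sp L (j + 1))) := by
  rw [Ham, Finset.mul_sum, Finset.sum_mul, ← Finset.sum_sub_distrib]
  refine Finset.sum_congr rfl fun j _ => ?_
  have hp := twistPhase_ne_zero L j
  have hA := twistMat_conj_of_mul_eq_smul L (Sp_mul_Sm_mul_twistMat L j (j + 1))
  have hB := twistMat_conj_of_mul_eq_smul L (Sm_mul_Sp_mul_twistMat L j (j + 1))
  rw [twistPhase_add_one L hL, mul_div_cancel_right₀ _ hp] at hA
  rw [twistPhase_add_one L hL, div_mul_cancel_right₀ hp] at hB
  rw [Sx_mul_Sx_add_Sy_mul_Sy]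
  simp only [Matrix.mul_add, Matrix.add_mul, Matrix.mul_sub, Matrix.sub_mul, Matrix.mul_smul,
    Matrix.smul_mul, hA, hB, twistMat_conj_Sz, twistMat_conj_Sz_mul_Sz]
  module

/-- A real vector has the same expectation value in a matrix and in its transpose. -/
theorem star_dotProduct_transpose_mulVec {n : Type*} [Fintype n] {ψ : n → ℂ}
    (hψ : ∀ s, (ψ s).im = 0) (A : Matrix n n ℂ) :
    star ψ ⬝ᵥ (Aᵀ.mulVec ψ) = star ψ ⬝ᵥ (A.mulVec ψ) := by
  have hstar : star ψ = ψ := funext fun s => Complex.conj_eq_iff_im.2 (hψ s)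
  rw [hstar, Matrix.mulVec_transpose, dotProduct_comm, Matrix.dotProduct_mulVec]

/-- For a vector `ψ` with real entries, the antisymmetric part
`∑_j (S⁺_j S⁻_{j+1} − S⁻_j S⁺_{j+1})` has vanishing expectation value, and hence
the energy difference `ψ† (U⁻¹ H U − H) ψ` reduces to the symmetric part
`(J/2)(cos(2π/L) − 1) ∑_j ψ† (S⁺_j S⁻_{j+1} + S⁻_j S⁺_{j+1}) ψ`. -/
theorem twist_energy_difference_real_vector (L : ℕ) [NeZero L] (hL : 2 ≤ L)
    (J : ℝ) (h : Fin L → ℝ) (ψ : (Fin L → Bool) → ℂ)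
    (hψ : ∀ s : Fin L → Bool, (ψ s).im = 0) :
    star ψ ⬝ᵥ ((∑ j : Fin L,
        (Sp L j * Sm L (j + 1) - Sm L j * Sp L (j + 1))).mulVec ψ) = 0
      ∧
    star ψ ⬝ᵥ (((twistMat L)⁻¹ * Ham L J h * twistMat L - Ham L J h).mulVec ψ)
      = ((J : ℂ) / 2) * ((Real.cos (2 * Real.pi / L) : ℝ) - 1) *
          ∑ j : Fin L,
            star ψ ⬝ᵥ ((Sp L j * Sm L (j + 1) + Sm L j * Sp L (j + 1)).mulVec ψ) := by
  have hne : ∀ j : Fin L, j ≠ j + 1 := by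
    intro j hj
    have h1 : (1 : Fin L) = 0 := by simpa using hj.symm
    have h2 := congrArg Fin.val h1
    rw [Fin.val_one', Nat.mod_eq_of_lt (by omega)] at h2
    simp at h2
  have hexp : ∀ j : Fin L, star ψ ⬝ᵥ ((Sm L j * Sp L (j + 1)).mulVec ψ)
      = star ψ ⬝ᵥ ((Sp L j * Sm L (j + 1)).mulVec ψ) := by
    intro j
    rw [← Sp_mul_Sm_comm L (hne j), ← star_dotProduct_transpose_mulVec hψ, Matrix.transpose_mul]
    simp only [Sm, Matrix.transpose_transpose]
  refine ⟨?_, ?_⟩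
  · rw [Matrix.sum_mulVec, dotProduct_sum]
    refine Finset.sum_eq_zero fun j _ => ?_
    rw [Matrix.sub_mulVec, dotProduct_sub, hexp, sub_self]
  · have hcos : Complex.exp (2 * Real.pi * Complex.I / L)
        + (Complex.exp (2 * Real.pi * Complex.I / L))⁻¹
          = 2 * ((Real.cos (2 * Real.pi / L) : ℝ) : ℂ) := by
      rw [Complex.ofReal_cos, Complex.two_cos, ← Complex.exp_neg]
      push_cast
      ring_nf
    rw [twistMat_conj_Ham_sub_Ham L hL, Matrix.sum_mulVec, dotProduct_sum, Finset.mul_sum]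
    refine Finset.sum_congr rfl fun j _ => ?_
    simp only [Matrix.smul_mulVec, Matrix.add_mulVec, dotProduct_smul, dotProduct_add, hexp,
      smul_eq_mul]
    linear_combination ((J : ℂ) / 2) * (star ψ ⬝ᵥ ((Sp L j * Sm L (j + 1)).mulVec ψ)) * hcos
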